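/- arXiv:math/0503738 — 2 statements merged into one kernel-verified Lean document; each statement's English description precedes it below -/
import Mathlib

section
/- Let n ≥ 2. For every l ∈ {1,…,n}, let X_{n,l} be the depth of the node containing l in the random binary search tree built from a uniformly random permutation of {1,…,n}. Then sup_{l ∈ {1,…,n}} d_TV(L(X_{n,l}), Po(E X_{n,l})) ≤ (28 + π²)/log n. -/
open MeasureTheory ProbabilityTheory Finset Filter
open scoped ENNReal NNReal

noncomputable section

/-- The `k`-th harmonic number `H_k = ∑_{i=1}^k 1/i`, with `H_0 = 0`. -/
def harm (k : ℕ) : ℝ := ∑ i ∈ Finset.range k, (1 : ℝ) / (i + 1)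

instance (n : ℕ) : MeasurableSpace (Equiv.Perm (Fin n)) := ⊤

/-- The uniform distribution on the permutations of `{1,…,n}`. -/
def uniformPerm (n : ℕ) : Measure (Equiv.Perm (Fin n)) :=
  (PMF.uniformOfFintype (Equiv.Perm (Fin n))).toMeasure

/-- The (1-based) position `N = π⁻¹(l)` of the key `l` in the permutation `π`
(positions are `i+1` for `i : Fin n`, values are `π i + 1`). -/
def bstN (n l : ℕ) (π : Equiv.Perm (Fin n)) : ℕ :=
  1 + ∑ i : Fin n, if (π i : ℕ) + 1 = l then (i : ℕ) else 0

open scoped Classical in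
/-- `R₋`: the number of ascending records in the subpermutation of values `< l`
appearing before the position of `l`. -/
def bstRminus (n l : ℕ) (π : Equiv.Perm (Fin n)) : ℕ :=
  (Finset.univ.filter fun r : Fin n =>
    (r : ℕ) + 1 < bstN n l π ∧ (π r : ℕ) + 1 < l ∧
      ∀ k : Fin n, k < r → (π k : ℕ) + 1 < l → π k < π r).card

open scoped Classical in
/-- `R₊`: the number of descending records in the subpermutation of values `> l`
appearing before the position of `l`. -/
def bstRplus (n l : ℕ) (π : Equiv.Perm (Fin n)) : ℕ :=
  (Finset.univ.filter fun r : Fin n =>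
    (r : ℕ) + 1 < bstN n l π ∧ (π r : ℕ) + 1 > l ∧
      ∀ k : Fin n, k < r → (π k : ℕ) + 1 > l → π r < π k).card

/-- `X_{n,l} = R₋ + R₊`: the depth of the node containing `l` in the binary search
tree built from the permutation `π` of `{1,…,n}`. -/
def bstDepth (n l : ℕ) (π : Equiv.Perm (Fin n)) : ℕ :=
  bstRminus n l π + bstRplus n l π

open scoped Classical in
/-- `G = #{1 ≤ i < N : π(i) < l}`. -/
def bstG (n l : ℕ) (π : Equiv.Perm (Fin n)) : ℕ :=
  (Finset.univ.filter fun i : Fin n =>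
    (i : ℕ) + 1 < bstN n l π ∧ (π i : ℕ) + 1 < l).card

/-- The expectation `E X_{n,l}` of the depth of the node containing `l`. -/
def bstExp (n l : ℕ) : ℝ := ∫ π, (bstDepth n l π : ℝ) ∂(uniformPerm n)

/-- The hypergeometric probability mass function: for `X ~ HypGeo(N; M, n)`,
`P(X = k) = C(M,k)·C(N−M,n−k)/C(N,n)` for `0 ≤ k ≤ n` (and `0` otherwise). -/
def hypPMF (N M n k : ℕ) : ℝ :=
  if k ≤ n then (M.choose k * (N - M).choose (n - k) : ℝ) / (N.choose n) else 0

/-- Total variation distance between (probability) measures on `ℕ`. -/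
def dTV (μ ν : Measure ℕ) : ℝ := ⨆ A : Set ℕ, |(μ A).toReal - (ν A).toReal|

/-- The Wasserstein-type distance `d_W` of Barbour–Holst–Janson: the supremum of
`|∫ f dμ − ∫ f dν|` over measurable `f` with `|f(x) − f(y)| ≤ 1` whenever `|x − y| ≤ 1`. -/
def dW (μ ν : Measure ℝ) : ℝ :=
  sSup { d : ℝ | ∃ f : ℝ → ℝ, Measurable f ∧ (∀ x y, |x - y| ≤ 1 → |f x - f y| ≤ 1) ∧
    d = |∫ x, f x ∂μ - ∫ x, f x ∂ν| }

/-- The mixed Poisson distribution with mixing measure `ν`: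
`MixPo(ν)({k}) = ∫ e^{−λ} λ^k / k! ν(dλ)`. -/
def mixPo (ν : Measure ℝ) : Measure ℕ :=
  Measure.sum fun k =>
    (∫⁻ l, ENNReal.ofReal (Real.exp (-l) * l ^ k / k.factorial) ∂ν) • Measure.dirac k

/-- The standard normal cumulative distribution function `Φ`. -/
def stdNormalCDF (x : ℝ) : ℝ :=
  (1 / Real.sqrt (2 * Real.pi)) * ∫ y in Set.Iic x, Real.exp (-y ^ 2 / 2)

end

/-- The expectation of `f Z`, where `Z` is the total number of records in two independent uniformly
random permutations of lengths `c` and `d`. -/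
noncomputable def recordMean : ℕ → ℕ → (ℕ → ℝ) → ℝ
  | 0, 0, f => f 0
  | 0, d + 1, f =>
    d / (d + 1) * recordMean 0 d f + 1 / (d + 1) * recordMean 0 d (fun k => f (k + 1))
  | c + 1, d, f =>
    c / (c + 1) * recordMean c d f + 1 / (c + 1) * recordMean c d (fun k => f (k + 1))

lemma recordMean_succ_left (c d : ℕ) (f : ℕ → ℝ) :
    recordMean (c + 1) d f =
      c / (c + 1) * recordMean c d f + 1 / (c + 1) * recordMean c d (fun k => f (k + 1)) := by
  rw [recordMean]

lemma recordMean_succ_right (c d : ℕ) (f : ℕ → ℝ) :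
    recordMean c (d + 1) f =
      d / (d + 1) * recordMean c d f + 1 / (d + 1) * recordMean c d (fun k => f (k + 1)) := by
  induction c generalizing f with
  | zero => rw [recordMean]
  | succ c ih =>
    simp only [recordMean_succ_left, ih]
    ring

lemma recordMean_sub (c d : ℕ) (f g : ℕ → ℝ) :
    recordMean c d (fun k => f k - g k) = recordMean c d f - recordMean c d g := by
  induction c generalizing f g with
  | zero =>
    induction d generalizing f g with
    | zero => simp [recordMean]
    | succ d ih => simp only [recordMean_succ_right, ih]; ring
  | succ c ih => simp only [recordMean_succ_left, ih]; ring

lemma recordMean_mul (c d : ℕ) (a : ℝ) (f : ℕ → ℝ) :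
    recordMean c d (fun k => a * f k) = a * recordMean c d f := by
  induction c generalizing f with
  | zero =>
    induction d generalizing f with
    | zero => simp [recordMean]
    | succ d ih => simp only [recordMean_succ_right, ih]; ring
  | succ c ih => simp only [recordMean_succ_left, ih]; ring

lemma recordMean_const (c d : ℕ) (a : ℝ) : recordMean c d (fun _ => a) = a := by
  induction c with
  | zero =>
    induction d with
    | zero => simp [recordMean]
    | succ d ih => simp only [recordMean_succ_right, ih]; field_simp
  | succ c ih => simp only [recordMean_succ_left, ih]; field_simp

lemma recordMean_mono (c d : ℕ) {f g : ℕ → ℝ} (h : ∀ k, f k ≤ g k) :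
    recordMean c d f ≤ recordMean c d g := by
  induction c generalizing f g with
  | zero =>
    induction d generalizing f g with
    | zero => simpa [recordMean] using h 0
    | succ d ih =>
      simp only [recordMean_succ_right]
      have := ih h
      have := ih (f := fun k => f (k + 1)) (g := fun k => g (k + 1)) fun k => h (k + 1)
      gcongr
  | succ c ih =>
    simp only [recordMean_succ_left]
    have := ih h
    have := ih (f := fun k => f (k + 1)) (g := fun k => g (k + 1)) fun k => h (k + 1)
    gcongr

lemma abs_recordMean_le (c d : ℕ) {f : ℕ → ℝ} {a : ℝ} (h : ∀ k, |f k| ≤ a) :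
    |recordMean c d f| ≤ a := by
  rw [abs_le]
  constructor
  · rw [← recordMean_const c d (-a)]
    exact recordMean_mono c d fun k => (abs_le.1 (h k)).1
  · rw [← recordMean_const c d a]
    exact recordMean_mono c d fun k => (abs_le.1 (h k)).2

lemma harm_succ (k : ℕ) : harm (k + 1) = harm k + 1 / (k + 1) := by
  simp [harm, Finset.sum_range_succ]

lemma harm_zero : harm 0 = 0 := by simp [harm]

lemma recordMean_id (c d : ℕ) : recordMean c d (fun k => (k : ℝ)) = harm c + harm d := by
  have key (c d : ℕ) : recordMean c d (fun k => ((k + 1 : ℕ) : ℝ)) =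
      recordMean c d (fun k => (k : ℝ)) + 1 := by
    have := recordMean_sub c d (fun k => ((k + 1 : ℕ) : ℝ)) (fun k => (k : ℝ))
    simp only [Nat.cast_add, Nat.cast_one, add_sub_cancel_left, recordMean_const] at this ⊢
    linarith
  induction c with
  | zero =>
    induction d with
    | zero => simp [recordMean, harm_zero]
    | succ d ih => rw [recordMean_succ_right, key, ih, harm_succ]; field_simp; ring
  | succ c ih => rw [recordMean_succ_left, key, ih, harm_succ]; field_simp; ring

lemma abs_recordMean_sub_le_left (c c' d : ℕ) {f : ℕ → ℝ} {δ : ℝ}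
    (h : ∀ k, |f (k + 1) - f k| ≤ δ) :
    |recordMean c d f - recordMean c' d f| ≤ δ * |harm c - harm c'| := by
  have step (c e : ℕ) :
      |recordMean (c + e) d f - recordMean c d f| ≤ δ * (harm (c + e) - harm c) := by
    induction e with
    | zero => simp
    | succ e ih =>
      have h1 : recordMean (c + e + 1) d f - recordMean (c + e) d f =
          1 / ((c + e : ℕ) + 1 : ℝ) * recordMean (c + e) d (fun k => f (k + 1) - f k) := by
        rw [recordMean_sub, recordMean_succ_left]
        field_simp
        ring
      have h2 : |recordMean (c + e + 1) d f - recordMean (c + e) d f| ≤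
          1 / ((c + e : ℕ) + 1 : ℝ) * δ := by
        rw [h1, abs_mul, abs_of_nonneg (by positivity)]
        gcongr
        exact abs_recordMean_le _ _ h
      have h3 := abs_sub_le (recordMean (c + e + 1) d f) (recordMean (c + e) d f) (recordMean c d f)
      have h4 := harm_succ (c + e)
      rw [← add_assoc, h4]
      linarith
  have mono (c e : ℕ) : harm c ≤ harm (c + e) := by
    unfold harm
    apply Finset.sum_le_sum_of_subset_of_nonneg
    · simp
    · intros; positivity
  rcases le_total c c' with hc | hc
  · obtain ⟨e, rfl⟩ := Nat.exists_eq_add_of_le hc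
    rw [abs_sub_comm, abs_sub_comm (harm c), abs_of_nonneg (sub_nonneg.2 (mono c e))]
    exact step c e
  · obtain ⟨e, rfl⟩ := Nat.exists_eq_add_of_le hc
    rw [abs_of_nonneg (sub_nonneg.2 (mono c' e))]
    exact step c' e

lemma recordMean_comm (c d : ℕ) (f : ℕ → ℝ) : recordMean c d f = recordMean d c f := by
  induction c generalizing f with
  | zero =>
    induction d generalizing f with
    | zero => rfl
    | succ d ih => rw [recordMean_succ_right, recordMean_succ_left, ih, ih]
  | succ c ih => rw [recordMean_succ_right, recordMean_succ_left, ih, ih]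

lemma abs_recordMean_sub_le (c c' d d' : ℕ) {f : ℕ → ℝ} {δ : ℝ}
    (h : ∀ k, |f (k + 1) - f k| ≤ δ) :
    |recordMean c d f - recordMean c' d' f| ≤ δ * (|harm c - harm c'| + |harm d - harm d'|) := by
  have h1 := abs_recordMean_sub_le_left c c' d h
  have h2 := abs_recordMean_sub_le_left d d' c' h
  rw [recordMean_comm d, recordMean_comm d'] at h2
  linarith [abs_sub_le (recordMean c d f) (recordMean c' d f) (recordMean c' d' f)]

/-- The Stein operator applied to a sum of independent indicators, when one more indicator of
success probability `1 / (c + 1)` is added. -/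
lemma stein_step {c : ℕ} {s q δ A B C D E : ℝ} (h1 : |s * B - A| ≤ q * δ)
    (h2 : |s * C - D| ≤ q * δ) (h3 : |C - B| ≤ δ) (hE : E = D + B) :
    |(s + 1 / (c + 1)) * (c / (c + 1) * B + 1 / (c + 1) * C) -
      (c / (c + 1) * A + 1 / (c + 1) * E)| ≤ (q + (1 / (c + 1)) ^ 2) * δ := by
  have hc : (c : ℝ) / (c + 1) = 1 - 1 / (c + 1) := by field_simp; ring
  have hp0 : (0 : ℝ) ≤ 1 / (c + 1) := by positivity
  have hp1 : (1 : ℝ) / (c + 1) ≤ 1 := by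
    rw [div_le_one (by positivity)]; linarith [(Nat.cast_nonneg c : (0 : ℝ) ≤ c)]
  rw [hc, hE]
  generalize (1 : ℝ) / (c + 1) = p at *
  rw [abs_le] at *
  have e : (s + p) * ((1 - p) * B + p * C) - ((1 - p) * A + p * (D + B)) =
    (1 - p) * (s * B - A) + p * (s * C - D) + p ^ 2 * (C - B) := by ring
  rw [e]
  have hp2 : 0 ≤ 1 - p := by linarith
  constructor
  · linarith [mul_le_mul_of_nonneg_left h1.1 hp2, mul_le_mul_of_nonneg_left h2.1 hp0,
      mul_le_mul_of_nonneg_left h3.1 (sq_nonneg p)]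
  · linarith [mul_le_mul_of_nonneg_left h1.2 hp2, mul_le_mul_of_nonneg_left h2.2 hp0,
      mul_le_mul_of_nonneg_left h3.2 (sq_nonneg p)]

lemma abs_stein_recordMean_le_sum (c d : ℕ) {f : ℕ → ℝ} {δ : ℝ}
    (h : ∀ k, |f (k + 2) - f (k + 1)| ≤ δ) :
    |(harm c + harm d) * recordMean c d (fun k => f (k + 1)) - recordMean c d (fun k => k * f k)| ≤
      (∑ i ∈ Finset.range c, (1 / (i + 1 : ℝ)) ^ 2 + ∑ i ∈ Finset.range d, (1 / (i + 1 : ℝ)) ^ 2)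
        * δ := by
  have lip (c d : ℕ) (f : ℕ → ℝ) (h : ∀ k, |f (k + 2) - f (k + 1)| ≤ δ) :
      |recordMean c d (fun k => f (k + 2)) - recordMean c d (fun k => f (k + 1))| ≤ δ := by
    rw [← recordMean_sub]
    exact abs_recordMean_le _ _ h
  have split (c d : ℕ) (f : ℕ → ℝ) : recordMean c d (fun k => ((k + 1 : ℕ) : ℝ) * f (k + 1)) =
      recordMean c d (fun k => (k : ℝ) * f (k + 1)) + recordMean c d (fun k => f (k + 1)) := by
    rw [← sub_eq_iff_eq_add, ← recordMean_sub]
    congr 1; ext k; push_cast; ring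
  induction c generalizing f with
  | zero =>
    induction d generalizing f with
    | zero => simp [recordMean, harm_zero]
    | succ d ih =>
      have h1 := ih h
      have h2 := ih (f := fun k => f (k + 1)) fun k => h (k + 1)
      have := stein_step (c := d) h1 h2 (lip _ _ _ h) (split _ _ _)
      simp only [recordMean_succ_right, harm_succ, Finset.sum_range_succ]
      convert this using 2 <;> ring
  | succ c ih =>
    have h1 := ih h
    have h2 := ih (f := fun k => f (k + 1)) fun k => h (k + 1)
    have := stein_step (c := c) h1 h2 (lip _ _ _ h) (split _ _ _)
    simp only [recordMean_succ_left, harm_succ, Finset.sum_range_succ]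
    convert this using 2 <;> ring

lemma sum_sq_inv_le_two (c : ℕ) : ∑ i ∈ Finset.range c, (1 / (i + 1 : ℝ)) ^ 2 ≤ 2 := by
  have key (c : ℕ) :
      ∑ i ∈ Finset.range (c + 1), (1 / (i + 1 : ℝ)) ^ 2 ≤ 2 - 1 / (c + 1 : ℝ) := by
    induction c with
    | zero => norm_num
    | succ c ih =>
      rw [Finset.sum_range_succ]
      have : (1 / ((c + 1 : ℕ) + 1 : ℝ)) ^ 2 ≤ 1 / (c + 1 : ℝ) - 1 / ((c + 1 : ℕ) + 1 : ℝ) := by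
        push_cast
        rw [div_sub_div _ _ (by positivity) (by positivity), div_pow,
          div_le_div_iff₀ (by positivity) (by positivity)]
        nlinarith [(Nat.cast_nonneg c : (0 : ℝ) ≤ c)]
      linarith
  cases c with
  | zero => norm_num
  | succ c => linarith [key c, show (0 : ℝ) ≤ 1 / (c + 1 : ℝ) by positivity]

lemma abs_stein_recordMean_le (c d : ℕ) {f : ℕ → ℝ} {δ : ℝ}
    (h : ∀ k, |f (k + 2) - f (k + 1)| ≤ δ) :
    |(harm c + harm d) * recordMean c d (fun k => f (k + 1)) - recordMean c d (fun k => k * f k)| ≤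
      4 * δ := by
  have hδ : 0 ≤ δ := (abs_nonneg _).trans (h 0)
  refine (abs_stein_recordMean_le_sum c d h).trans ?_
  gcongr
  linarith [sum_sq_inv_le_two c, sum_sq_inv_le_two d]

/-- The expectation of `φ G H`, where `G` and `H` are the numbers of keys smaller, respectively
larger, than the key `a + 1` and inserted before it, in a uniformly random permutation of
`{1, …, a + b + 1}`. -/
noncomputable def prefixMean : ℕ → ℕ → (ℕ → ℕ → ℝ) → ℝ
  | 0, 0, φ => φ 0 0
  | 0, b + 1, φ => ((b + 1) * prefixMean 0 b φ + φ 0 (b + 1)) / (b + 2)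
  | a + 1, 0, φ => ((a + 1) * prefixMean a 0 φ + φ (a + 1) 0) / (a + 2)
  | a + 1, b + 1, φ => ((a + 1) * prefixMean a (b + 1) φ + (b + 1) * prefixMean (a + 1) b φ +
      φ (a + 1) (b + 1)) / (a + b + 3)

lemma prefixMean_rec (a b : ℕ) (φ : ℕ → ℕ → ℝ) :
    prefixMean a b φ = (a * prefixMean (a - 1) b φ + b * prefixMean a (b - 1) φ + φ a b) /
      (a + b + 1) := by
  rcases a with _ | a <;> rcases b with _ | b <;> conv_lhs => rw [prefixMean]
  · simp
  all_goals
    push_cast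
    ring_nf

lemma prefixMean_induction {P : ℕ → ℕ → Prop}
    (h : ∀ a b, (a ≠ 0 → P (a - 1) b) → (b ≠ 0 → P a (b - 1)) → P a b) (a b : ℕ) : P a b := by
  induction hn : a + b using Nat.strong_induction_on generalizing a b with
  | _ n ih =>
    exact h a b (fun ha => ih (a - 1 + b) (by omega) _ _ rfl)
      (fun hb => ih (a + (b - 1)) (by omega) _ _ rfl)

/-- A recursive criterion for identifying the mean `prefixMean`. -/
lemma eq_prefixMean {T : ℕ → ℕ → ℝ} {φ : ℕ → ℕ → ℝ}
    (h : ∀ a b : ℕ, T a b * (a + b + 1) = a * T (a - 1) b + b * T a (b - 1) + φ a b) (a b : ℕ) :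
    T a b = prefixMean a b φ := by
  induction a, b using prefixMean_induction with
  | h a b ha hb =>
    rw [prefixMean_rec, eq_div_iff (by positivity), h]
    rcases eq_or_ne a 0 with rfl | h1 <;> rcases eq_or_ne b 0 with rfl | h2 <;> simp_all

lemma prefixMean_add (a b : ℕ) (φ ψ : ℕ → ℕ → ℝ) :
    prefixMean a b φ + prefixMean a b ψ = prefixMean a b (fun g h => φ g h + ψ g h) := by
  refine eq_prefixMean (T := fun a b => prefixMean a b φ + prefixMean a b ψ) (fun a b => ?_) a b
  rw [prefixMean_rec a b φ, prefixMean_rec a b ψ]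
  field_simp
  ring

lemma prefixMean_mul (a b : ℕ) (x : ℝ) (φ : ℕ → ℕ → ℝ) :
    x * prefixMean a b φ = prefixMean a b (fun g h => x * φ g h) := by
  refine eq_prefixMean (T := fun a b => x * prefixMean a b φ) (fun a b => ?_) a b
  rw [prefixMean_rec a b φ]
  field_simp

lemma prefixMean_sub (a b : ℕ) (φ ψ : ℕ → ℕ → ℝ) :
    prefixMean a b φ - prefixMean a b ψ = prefixMean a b (fun g h => φ g h - ψ g h) := by
  rw [sub_eq_iff_eq_add, prefixMean_add]
  simp

lemma prefixMean_fst (a b : ℕ) (φ : ℕ → ℝ) :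
    (∑ g ∈ Finset.range (a + 1), φ g) / (a + 1) = prefixMean a b (fun g _ => φ g) := by
  refine eq_prefixMean (T := fun a _ => (∑ g ∈ Finset.range (a + 1), φ g) / (a + 1))
    (fun a b => ?_) a b
  rcases a with _ | a
  · simp; ring
  · simp only [Nat.add_sub_cancel, Finset.sum_range_succ _ (a + 1)]
    push_cast
    field_simp
    ring

lemma prefixMean_snd (a b : ℕ) (φ : ℕ → ℝ) :
    (∑ h ∈ Finset.range (b + 1), φ h) / (b + 1) = prefixMean a b (fun _ h => φ h) := by
  refine eq_prefixMean (T := fun _ b => (∑ g ∈ Finset.range (b + 1), φ g) / (b + 1))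
    (fun a b => ?_) a b
  rcases b with _ | b
  · simp; ring
  · simp only [Nat.add_sub_cancel, Finset.sum_range_succ _ (b + 1)]
    push_cast
    field_simp
    ring

lemma prefixMean_const (a b : ℕ) (x : ℝ) : prefixMean a b (fun _ _ => x) = x := by
  rw [← prefixMean_fst a b (fun _ => x)]
  simp
  field_simp

lemma prefixMean_nonneg (a b : ℕ) {φ : ℕ → ℕ → ℝ} (h : ∀ g h, 0 ≤ φ g h) :
    0 ≤ prefixMean a b φ := by
  induction a, b using prefixMean_induction with
  | h a b ha hb =>
    rw [prefixMean_rec]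
    have h0 := h a b
    have h1 : 0 ≤ a * prefixMean (a - 1) b φ := by
      rcases eq_or_ne a 0 with rfl | h1
      · simp
      · exact mul_nonneg (by positivity) (ha h1)
    have h2 : 0 ≤ b * prefixMean a (b - 1) φ := by
      rcases eq_or_ne b 0 with rfl | h2
      · simp
      · exact mul_nonneg (by positivity) (hb h2)
    positivity

lemma prefixMean_mono (a b : ℕ) {φ ψ : ℕ → ℕ → ℝ} (h : ∀ g h, φ g h ≤ ψ g h) :
    prefixMean a b φ ≤ prefixMean a b ψ := by
  rw [← sub_nonneg, prefixMean_sub]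
  exact prefixMean_nonneg a b fun g k => sub_nonneg.2 (h g k)

lemma abs_prefixMean_le (a b : ℕ) {φ ψ : ℕ → ℕ → ℝ} (h : ∀ g h, |φ g h| ≤ ψ g h) :
    |prefixMean a b φ| ≤ prefixMean a b ψ := by
  rw [abs_le]
  constructor
  · have := prefixMean_mono a b fun g k => (abs_le.1 (h g k)).1
    have e := prefixMean_mul a b (-1) ψ
    simp only [neg_one_mul] at e
    linarith
  · exact prefixMean_mono a b fun g k => (abs_le.1 (h g k)).2

lemma harm_mono : Monotone harm := by
  refine monotone_nat_of_le_succ fun k => ?_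
  rw [harm_succ]
  linarith [show (0 : ℝ) ≤ 1 / (k + 1 : ℝ) by positivity]

lemma sum_harm_sub (a : ℕ) : ∑ g ∈ Finset.range (a + 1), (harm a - harm g) = a := by
  induction a with
  | zero => simp
  | succ a ih =>
    rw [Finset.sum_range_succ, harm_succ]
    simp only [add_sub_right_comm _ _ (harm _), Finset.sum_add_distrib, ih]
    simp
    field_simp

lemma sum_harm_sub_sq_le (a : ℕ) :
    ∑ g ∈ Finset.range (a + 1), (harm a - harm g) ^ 2 ≤ 2 * a := by
  induction a with
  | zero => simp
  | succ a ih =>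
    have e : ∑ g ∈ Finset.range (a + 1), (harm (a + 1) - harm g) ^ 2 =
        ∑ g ∈ Finset.range (a + 1), (harm a - harm g) ^ 2 +
          2 / (a + 1) * ∑ g ∈ Finset.range (a + 1), (harm a - harm g) +
            ∑ g ∈ Finset.range (a + 1), (1 / (a + 1 : ℝ)) ^ 2 := by
      rw [Finset.mul_sum, ← Finset.sum_add_distrib, ← Finset.sum_add_distrib]
      refine Finset.sum_congr rfl fun g _ => ?_
      rw [harm_succ]
      ring
    rw [Finset.sum_range_succ, e, sum_harm_sub, Finset.sum_const, Finset.card_range]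
    have : 2 / (a + 1 : ℝ) * a + (a + 1) • (1 / (a + 1 : ℝ)) ^ 2 ≤ 2 := by
      rw [nsmul_eq_mul]
      push_cast
      have h2 : 2 / (a + 1 : ℝ) * a + (a + 1) * (1 / (a + 1 : ℝ)) ^ 2 = (2 * a + 1) / (a + 1) := by
        field_simp
      rw [h2, div_le_iff₀ (by positivity)]
      linarith
    push_cast
    linarith

lemma sum_abs_harm_sub (a : ℕ) :
    (∑ g ∈ Finset.range (a + 1), |harm g - harm a|) / (a + 1) ≤ 1 := by
  have : ∑ g ∈ Finset.range (a + 1), |harm g - harm a| = a := by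
    rw [← sum_harm_sub a]
    refine Finset.sum_congr rfl fun g hg => ?_
    rw [abs_sub_comm, abs_of_nonneg]
    exact sub_nonneg.2 (harm_mono (Nat.lt_succ_iff.1 (Finset.mem_range.1 hg)))
  rw [this, div_le_one (by positivity)]
  linarith

lemma sum_sq_harm_sub (a : ℕ) :
    (∑ g ∈ Finset.range (a + 1), (harm g - harm a) ^ 2) / (a + 1) ≤ 2 := by
  rw [div_le_iff₀ (by positivity)]
  refine le_trans (le_of_eq (Finset.sum_congr rfl fun g _ => ?_))
    ((sum_harm_sub_sq_le a).trans (by linarith))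
  ring

lemma prefixMean_dev_le (a b : ℕ) :
    prefixMean a b (fun g h => |harm g - harm a| + |harm h - harm b|) ≤ 2 := by
  rw [← prefixMean_add, ← prefixMean_fst a b fun g => |harm g - harm a|,
    ← prefixMean_snd a b fun g => |harm g - harm b|]
  linarith [sum_abs_harm_sub a, sum_abs_harm_sub b]

lemma prefixMean_dev_sq_le (a b : ℕ) :
    prefixMean a b (fun g h => (|harm g - harm a| + |harm h - harm b|) ^ 2) ≤ 8 := by
  have h1 : prefixMean a b (fun g h => (|harm g - harm a| + |harm h - harm b|) ^ 2) ≤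
      prefixMean a b (fun g h => 2 * (harm g - harm a) ^ 2 + 2 * (harm h - harm b) ^ 2) := by
    refine prefixMean_mono a b fun g h => ?_
    rw [← sq_abs (harm g - harm a), ← sq_abs (harm h - harm b)]
    nlinarith [sq_nonneg (|harm g - harm a| - |harm h - harm b|)]
  rw [← prefixMean_add, ← prefixMean_mul a b 2 fun g _ => (harm g - harm a) ^ 2,
    ← prefixMean_mul a b 2 fun _ h => (harm h - harm b) ^ 2,
    ← prefixMean_fst a b fun g => (harm g - harm a) ^ 2,
    ← prefixMean_snd a b fun g => (harm g - harm b) ^ 2] at h1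
  linarith [sum_sq_harm_sub a, sum_sq_harm_sub b]

/-- The mean of `harm G + harm H`, i.e. the mean depth. -/
noncomputable def meanDepth (a b : ℕ) : ℝ := prefixMean a b fun g h => harm g + harm h

lemma abs_sub_meanDepth_le (a b : ℕ) : |harm a + harm b - meanDepth a b| ≤ 2 := by
  have e : harm a + harm b - meanDepth a b =
      prefixMean a b fun g h => harm a + harm b - (harm g + harm h) := by
    rw [meanDepth, ← prefixMean_sub, prefixMean_const]
  rw [e]
  refine (abs_prefixMean_le a b fun g h => ?_).trans (prefixMean_dev_le a b)
  rw [abs_sub_comm, add_sub_add_comm]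
  exact abs_add_le _ _

lemma log_le_meanDepth (a b : ℕ) : Real.log (a + b + 1 : ℕ) - 2 ≤ meanDepth a b := by
  have key (k : ℕ) : Real.log (k + 1) ≤ harm k := by
    have := log_add_one_le_harmonic k
    simpa [harmonic, harm] using this
  have h1 : Real.log (a + b + 1 : ℕ) ≤ Real.log (a + 1) + Real.log (b + 1) := by
    rw [← Real.log_mul (by positivity) (by positivity)]
    apply Real.log_le_log (by positivity)
    push_cast
    nlinarith [mul_nonneg (Nat.cast_nonneg a : (0 : ℝ) ≤ a) (Nat.cast_nonneg b : (0 : ℝ) ≤ b)]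
  linarith [key a, key b, (abs_le.1 (abs_sub_meanDepth_le a b)).2]

/-- The expectation of `f` at the depth of the key `a + 1` among `a + b + 1` keys. -/
noncomputable def depthMean (a b : ℕ) (f : ℕ → ℝ) : ℝ :=
  prefixMean a b fun g h => recordMean g h f

lemma depthMean_sub (a b : ℕ) (f g : ℕ → ℝ) :
    depthMean a b f - depthMean a b g = depthMean a b (fun k => f k - g k) := by
  simp only [depthMean, prefixMean_sub, recordMean_sub]

lemma depthMean_mul (a b : ℕ) (x : ℝ) (f : ℕ → ℝ) :
    x * depthMean a b f = depthMean a b (fun k => x * f k) := by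
  simp only [depthMean, prefixMean_mul, recordMean_mul]

lemma depthMean_const (a b : ℕ) (x : ℝ) : depthMean a b (fun _ => x) = x := by
  simp only [depthMean, recordMean_const, prefixMean_const]

lemma abs_stein_depthMean_le (a b : ℕ) {f : ℕ → ℝ} {δ : ℝ}
    (hf : ∀ k, |f (k + 2) - f (k + 1)| ≤ δ) :
    |depthMean a b (fun k => meanDepth a b * f (k + 1) - k * f k)| ≤ 16 * δ := by
  set m := meanDepth a b with hm
  have hδ : 0 ≤ δ := (abs_nonneg _).trans (hf 0)
  set r : ℕ → ℕ → ℝ := fun g h => recordMean g h fun k => f (k + 1) with hr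
  set D : ℕ → ℕ → ℝ := fun g h => |harm g - harm a| + |harm h - harm b| with hD
  have hzero : prefixMean a b (fun g h => (m - (harm g + harm h)) * r a b) = 0 := by
    simp only [mul_comm _ (r a b)]
    rw [← prefixMean_mul, ← prefixMean_sub, prefixMean_const, hm, meanDepth, sub_self, mul_zero]
  have hsplit : depthMean a b (fun k => m * f (k + 1) - k * f k) =
      prefixMean a b (fun g h => (m - (harm g + harm h)) * (r g h - r a b)) +
      prefixMean a b (fun g h => (harm g + harm h) * r g h - recordMean g h fun k => k * f k) := by
    rw [← sub_zero (depthMean _ _ _), ← hzero, depthMean, prefixMean_sub, prefixMean_add]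
    congr 1
    ext g h
    rw [recordMean_sub, recordMean_mul]
    ring
  have hone : |prefixMean a b (fun g h => (m - (harm g + harm h)) * (r g h - r a b))| ≤ 12 * δ := by
    have h1 : prefixMean a b (fun g h => δ * (D g h ^ 2 + 2 * D g h)) ≤ 12 * δ := by
      rw [← prefixMean_mul, ← prefixMean_add, ← prefixMean_mul]
      have := prefixMean_dev_sq_le a b
      have := prefixMean_dev_le a b
      nlinarith
    refine (abs_prefixMean_le a b fun g h => ?_).trans h1
    rw [abs_mul]
    have h2 : |r g h - r a b| ≤ δ * D g h := abs_recordMean_sub_le g a h b hf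
    have h3 : |m - (harm g + harm h)| ≤ 2 + D g h := by
      have := abs_sub_meanDepth_le a b
      rw [abs_sub_comm] at this
      have h4 := abs_sub_le m (harm a + harm b) (harm g + harm h)
      have h5 : |harm a + harm b - (harm g + harm h)| ≤ D g h := by
        rw [abs_sub_comm, add_sub_add_comm]
        exact abs_add_le _ _
      linarith
    calc _ ≤ (2 + D g h) * (δ * D g h) :=
          mul_le_mul h3 h2 (abs_nonneg _) (by positivity)
      _ = _ := by ring
  have htwo : |prefixMean a b
      (fun g h => (harm g + harm h) * r g h - recordMean g h fun k => k * f k)| ≤ 4 * δ := by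
    rw [← prefixMean_const a b (4 * δ)]
    exact abs_prefixMean_le a b fun g h => abs_stein_recordMean_le g h hf
  rw [hsplit]
  exact (abs_add_le _ _).trans (by linarith)

section PoissonStein

variable {p : ℕ → ℝ} {x : ℝ}

open Classical in
/-- The mass given by `p` to the elements of `A` that are at most `k`. -/
noncomputable def massLE (p : ℕ → ℝ) (A : Set ℕ) (k : ℕ) : ℝ :=
  ∑ i ∈ Finset.range (k + 1), if i ∈ A then p i else 0

/-- The solution of the Stein equation for the Poisson distribution `p` with parameter `x` and the
indicator function of `A`. -/
noncomputable def steinSol (p : ℕ → ℝ) (x : ℝ) (A : Set ℕ) : ℕ → ℝ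
  | 0 => 0
  | k + 1 => (massLE p A k - (∑' i, A.indicator p i) * massLE p Set.univ k) / (x * p k)

lemma massLE_succ (p : ℕ → ℝ) (A : Set ℕ) (k : ℕ) :
    massLE p A (k + 1) = massLE p A k + A.indicator p (k + 1) := by
  classical
  simp [massLE, Finset.sum_range_succ, Set.indicator_apply]

lemma massLE_zero (p : ℕ → ℝ) (A : Set ℕ) : massLE p A 0 = A.indicator p 0 := by
  classical
  simp [massLE, Set.indicator_apply]

lemma steinSol_eq (hx : 0 < x) (hp : ∀ k, 0 < p k) (hrec : ∀ k : ℕ, (k + 1) * p (k + 1) = x * p k)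
    (A : Set ℕ) (k : ℕ) :
    x * steinSol p x A (k + 1) - k * steinSol p x A k =
      A.indicator 1 k - ∑' i, A.indicator p i := by
  classical
  have ind (k : ℕ) : A.indicator p k = A.indicator 1 k * p k := by
    by_cases h : k ∈ A <;> simp [h]
  cases k with
  | zero =>
    have := (hp 0).ne'
    simp only [steinSol, massLE_zero, ind 0]
    simp
    field_simp
  | succ k =>
    have h1 := (hp k).ne'
    have h2 := (hp (k + 1)).ne'
    have h3 : ((k + 1 : ℕ) : ℝ) / (x * p k) = 1 / p (k + 1) := by
      rw [← hrec]; push_cast; field_simp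
    have h4 : x * steinSol p x A (k + 1 + 1) =
        (massLE p A (k + 1) - (∑' i, A.indicator p i) * massLE p Set.univ (k + 1)) / p (k + 1) := by
      rw [steinSol]; field_simp
    have h5 : ((k + 1 : ℕ) : ℝ) * steinSol p x A (k + 1) =
        (massLE p A k - (∑' i, A.indicator p i) * massLE p Set.univ k) / p (k + 1) := by
      rw [steinSol, mul_div_left_comm, h3]; ring
    rw [h4, h5, massLE_succ, massLE_succ, ind (k + 1)]
    simp
    field_simp
    ring

lemma massLE_add_tail (hs : Summable p) (A : Set ℕ) (k : ℕ) :
    massLE p A k + ∑' i, A.indicator p (i + (k + 1)) = ∑' i, A.indicator p i := by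
  classical
  rw [← (hs.indicator A).sum_add_tsum_nat_add (k + 1)]
  simp [massLE, Set.indicator_apply]

lemma massLE_nonneg (hp : ∀ k, 0 < p k) (A : Set ℕ) (k : ℕ) : 0 ≤ massLE p A k := by
  classical
  refine Finset.sum_nonneg fun i _ => ?_
  split_ifs
  · exact (hp i).le
  · exact le_rfl

lemma massLE_univ (p : ℕ → ℝ) (k : ℕ) : massLE p Set.univ k = ∑ i ∈ Finset.range (k + 1), p i := by
  simp [massLE]

/-- Upward increments of the ratio of the distribution function and the mass function. -/
lemma massLE_univ_ratio (hp : ∀ k, 0 < p k)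
    (hrec : ∀ k : ℕ, (k + 1) * p (k + 1) = x * p k) (k : ℕ) :
    massLE p Set.univ k * p (k + 1) ≤ massLE p Set.univ (k + 1) * p k := by
  have h (k : ℕ) : massLE p Set.univ k * x ≤ (k + 1) * (massLE p Set.univ (k + 1) - p 0) := by
    rw [massLE_univ, massLE_univ, Finset.sum_range_succ' _ (k + 1), add_sub_cancel_right,
      Finset.sum_mul, Finset.mul_sum]
    refine Finset.sum_le_sum fun i hi => ?_
    rw [mul_comm, ← hrec]
    have : (i : ℝ) ≤ k := by exact_mod_cast Nat.lt_succ_iff.1 (Finset.mem_range.1 hi)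
    exact mul_le_mul_of_nonneg_right (by linarith) (hp _).le
  have h1 := h k
  have h2 : massLE p Set.univ k * ((k + 1) * p (k + 1)) ≤
      (k + 1) * (massLE p Set.univ (k + 1) * p k) := by
    rw [hrec]
    nlinarith [mul_le_mul_of_nonneg_right h1 (hp k).le, mul_pos (hp 0) (hp k),
      mul_nonneg (mul_nonneg (Nat.cast_nonneg k : (0 : ℝ) ≤ k) (hp 0).le) (hp k).le]
  have h3 : (0 : ℝ) < k + 1 := by positivity
  exact le_of_mul_le_mul_left (by linarith) h3

/-- Downward increments of the ratio of the tail function and the mass function. -/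
lemma tail_ratio (hx : 0 < x) (hp : ∀ k, 0 < p k) (hs : Summable p)
    (hrec : ∀ k : ℕ, (k + 1) * p (k + 1) = x * p k) (k : ℕ) :
    (∑' i, p (i + (k + 2))) * p k ≤ (∑' i, p (i + (k + 1))) * p (k + 1) := by
  rw [← tsum_mul_right, ← tsum_mul_right]
  refine Summable.tsum_le_tsum (fun i => ?_) (((summable_nat_add_iff (k + 2)).2 hs).mul_right _)
    (((summable_nat_add_iff (k + 1)).2 hs).mul_right _)
  have h1 := hrec k
  have h2 := hrec (i + (k + 1))
  have h3 : p (i + (k + 2)) = x * p (i + (k + 1)) / (i + (k + 1) + 1) := by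
    rw [eq_div_iff (by positivity), ← h2]
    push_cast
    ring_nf
  have h4 : p (k + 1) = x * p k / (k + 1) := by
    rw [eq_div_iff (by positivity), ← h1]; ring
  rw [h3, h4, div_mul_eq_mul_div, ← mul_div_assoc]
  have := hp k
  have := hp (i + (k + 1))
  calc x * p (i + (k + 1)) * p k / (i + (k + 1) + 1) ≤ x * p (i + (k + 1)) * p k / (k + 1) := by
        apply div_le_div_of_nonneg_left (by positivity) (by positivity)
        linarith [(Nat.cast_nonneg i : (0 : ℝ) ≤ i)]
    _ = _ := by ring

/-- The Stein factor bound, one-sided. -/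
lemma steinSol_succ_sub_le (hx : 0 < x) (hp : ∀ k, 0 < p k) (hsum : HasSum p 1)
    (hrec : ∀ k : ℕ, (k + 1) * p (k + 1) = x * p k) (A : Set ℕ) (k : ℕ) :
    steinSol p x A (k + 2) - steinSol p x A (k + 1) ≤ 1 / x := by
  have hs := hsum.summable
  have tail (A : Set ℕ) (k : ℕ) := massLE_add_tail hs A k
  set a := massLE p A k
  set β := ∑' i, A.indicator p (i + (k + 1 + 1)) with hβ
  set ε := A.indicator p (k + 1) with hε
  set F := massLE p Set.univ k
  set V := ∑' i, p (i + (k + 2))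
  have ha : 0 ≤ a := massLE_nonneg hp A k
  have hb : 0 ≤ β := tsum_nonneg fun i => Set.indicator_nonneg (fun j _ => (hp j).le) _
  have hF : massLE p Set.univ (k + 1) = F + p (k + 1) := by rw [massLE_succ]; simp [F]
  have hA : massLE p A (k + 1) = a + ε := massLE_succ p A k
  have hP : ∑' i, A.indicator p i = a + ε + β := by rw [← tail A (k + 1), hA]
  have h1 : F + p (k + 1) + V = 1 := by
    have := tail Set.univ (k + 1)
    rw [hF] at this
    simp only [Set.indicator_univ, hsum.tsum_eq] at this
    exact this
  have h2 : ∑' i, p (i + (k + 1)) = p (k + 1) + V := by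
    have := tail Set.univ k
    simp only [Set.indicator_univ, hsum.tsum_eq] at this
    change F + _ = 1 at this
    linarith
  have hεp : 0 ≤ ε ∧ ε ≤ p (k + 1) := by
    by_cases h : k + 1 ∈ A
    · simp [hε, h, (hp _).le]
    · simp [hε, h, (hp _).le]
  have r1 := massLE_univ_ratio hp hrec k
  have r2 := tail_ratio hx hp hs hrec k
  rw [hF] at r1
  rw [h2] at r2
  change F * _ ≤ _ at r1
  change V * _ ≤ _ at r2
  rw [show k + 2 = (k + 1) + 1 from rfl, steinSol, steinSol, hF, hA, hP]
  change (a + ε - (a + ε + β) * (F + p (k + 1))) / (x * p (k + 1)) -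
    (a - (a + ε + β) * F) / (x * p k) ≤ 1 / x
  have hF0 : 0 ≤ F := massLE_nonneg hp _ k
  have q0 := hp k
  have q1 := hp (k + 1)
  generalize p (k + 1) = q at *
  generalize p k = r at *
  have key : (a + ε - (a + ε + β) * (F + q)) * r - (a - (a + ε + β) * F) * q ≤ q * r := by
    have hV0 : 0 ≤ V := tsum_nonneg fun i => (hp _).le
    clear_value V
    obtain rfl : V = 1 - F - q := by linarith
    have hVF : 0 ≤ (1 - F - q) * r + F * q := by positivity
    nlinarith [mul_le_mul_of_nonneg_left r1 hb, mul_le_mul_of_nonneg_left r2 ha,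
      mul_le_mul_of_nonneg_right hεp.2 hVF, mul_le_mul_of_nonneg_left r1 q1.le]
  calc _ = ((a + ε - (a + ε + β) * (F + q)) * r - (a - (a + ε + β) * F) * q) / (q * r) / x := by
        field_simp
    _ ≤ 1 / x := by
        gcongr
        rw [div_le_one (by positivity)]
        exact key

lemma steinSol_compl (hsum : HasSum p 1) (A : Set ℕ) (k : ℕ) :
    steinSol p x Aᶜ k = -steinSol p x A k := by
  cases k with
  | zero => simp [steinSol]
  | succ k =>
    have h1 : massLE p Aᶜ k = massLE p Set.univ k - massLE p A k := by
      rw [eq_sub_iff_add_eq, massLE, massLE, massLE, ← Finset.sum_add_distrib]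
      refine Finset.sum_congr rfl fun i _ => ?_
      by_cases h : i ∈ A <;> simp [h]
    have h2 : ∑' i, Aᶜ.indicator p i = 1 - ∑' i, A.indicator p i := by
      rw [eq_sub_iff_add_eq, ← (hsum.summable.indicator _).tsum_add (hsum.summable.indicator _),
        ← hsum.tsum_eq]
      refine tsum_congr fun i => ?_
      by_cases h : i ∈ A <;> simp [h]
    rw [steinSol, steinSol, h1, h2]
    ring

/-- The Stein factor bound for Poisson approximation. -/
lemma abs_steinSol_succ_sub_le (hx : 0 < x) (hp : ∀ k, 0 < p k) (hsum : HasSum p 1)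
    (hrec : ∀ k : ℕ, (k + 1) * p (k + 1) = x * p k) (A : Set ℕ) (k : ℕ) :
    |steinSol p x A (k + 2) - steinSol p x A (k + 1)| ≤ 1 / x := by
  have h1 := steinSol_succ_sub_le hx hp hsum hrec A k
  have h2 := steinSol_succ_sub_le hx hp hsum hrec Aᶜ k
  rw [steinSol_compl hsum, steinSol_compl hsum] at h2
  rw [abs_le]
  constructor <;> linarith

end PoissonStein

lemma abs_depthMean_sub_poisson_le (a b : ℕ) (hx : 0 < meanDepth a b) (A : Set ℕ) :
    |depthMean a b (A.indicator 1) - (poissonMeasure (meanDepth a b).toNNReal A).toReal| ≤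
      16 / meanDepth a b := by
  set x := meanDepth a b with hxdef
  set p : ℕ → ℝ := fun k => Real.exp (-x) * x ^ k / k.factorial with hpdef
  have hp (k : ℕ) : 0 < p k := by positivity
  have hsum : HasSum p 1 := by
    have := hasSum_one_poissonMeasure x.toNNReal
    rwa [Real.coe_toNNReal x hx.le] at this
  have hrec (k : ℕ) : (k + 1) * p (k + 1) = x * p k := by
    simp only [hpdef, Nat.factorial_succ, Nat.cast_mul, Nat.cast_succ, pow_succ]
    field_simp
  have hA : (poissonMeasure x.toNNReal A).toReal = ∑' i, A.indicator p i := by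
    have := integral_poissonMeasure x.toNNReal (A.indicator (1 : ℕ → ℝ))
    rw [integral_indicator_one (MeasurableSet.of_discrete)] at this
    rw [← measureReal_def, this, Real.coe_toNNReal x hx.le]
    refine tsum_congr fun i => ?_
    by_cases h : i ∈ A <;> simp [h, hpdef]
  have h1 := abs_stein_depthMean_le a b (abs_steinSol_succ_sub_le hx hp hsum hrec A)
  rw [← hxdef] at h1
  simp only [steinSol_eq hx hp hrec A] at h1
  rw [← depthMean_sub, depthMean_const] at h1
  rw [hA]
  exact h1.trans (by rw [mul_one_div])

section Permutations

/-- Append the value `q` to the word `π`, shifting up the letters of `π` that are at least `q`. -/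
noncomputable def appendPerm {n : ℕ} (q : Fin (n + 1)) (π : Equiv.Perm (Fin n)) :
    Equiv.Perm (Fin (n + 1)) :=
  Equiv.ofBijective (Fin.lastCases q fun i => q.succAbove (π i)) <| by
    rw [← Finite.injective_iff_bijective]
    intro i j h
    induction i using Fin.lastCases <;> induction j using Fin.lastCases <;>
      simp_all [Fin.succAbove_ne, (Fin.succAbove_ne _ _).symm]

@[simp] lemma appendPerm_last {n : ℕ} (q : Fin (n + 1)) (π : Equiv.Perm (Fin n)) :
    appendPerm q π (Fin.last n) = q := by
  simp [appendPerm]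

@[simp] lemma appendPerm_castSucc {n : ℕ} (q : Fin (n + 1)) (π : Equiv.Perm (Fin n)) (i : Fin n) :
    appendPerm q π i.castSucc = q.succAbove (π i) := by
  simp [appendPerm]

lemma sum_appendPerm {n : ℕ} (F : Equiv.Perm (Fin (n + 1)) → ℝ) :
    ∑ π, F π = ∑ q, ∑ π, F (appendPerm q π) := by
  rw [← Fintype.sum_prod_type']
  symm
  refine Function.Bijective.sum_comp (e := fun x : Fin (n + 1) × Equiv.Perm (Fin n) =>
    appendPerm x.1 x.2) ?_ F
  rw [Fintype.bijective_iff_injective_and_card]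
  constructor
  · rintro ⟨q, π⟩ ⟨q', π'⟩ h
    simp only at h
    have hq : q = q' := by simpa using congrArg (fun σ => σ (Fin.last n)) h
    subst hq
    have : π = π' := by
      ext1 i
      have := congrArg (fun σ => σ i.castSucc) h
      simpa using this
    rw [this]
  · simp [Fintype.card_perm, Nat.factorial_succ]

open scoped Classical in
/-- The number of ascending records among the letters of `π` less than `c` plus the number of
descending records among the other letters. -/
noncomputable def cutRecords (n c : ℕ) (π : Equiv.Perm (Fin n)) : ℕ :=
  ∑ r : Fin n, if ((π r : ℕ) < c → ∀ k < r, (π k : ℕ) < c → π k < π r) ∧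
    (c ≤ π r → ∀ k < r, c ≤ π k → π r < π k) then 1 else 0

open scoped Classical in
/-- The depth of the letter `v`, as a count over positions. -/
noncomputable def letterDepth (n : ℕ) (v : Fin n) (π : Equiv.Perm (Fin n)) : ℕ :=
  ∑ r : Fin n, if (∀ k ≤ r, π k ≠ v) ∧ (π r < v → ∀ k < r, π k < v → π k < π r) ∧
    (v < π r → ∀ k < r, v < π k → π r < π k) then 1 else 0

lemma bstN_eq (n : ℕ) (v : Fin n) (π : Equiv.Perm (Fin n)) :
    bstN n (v + 1) π = 1 + (π.symm v : ℕ) := by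
  unfold bstN
  congr 1
  rw [Finset.sum_eq_single (π.symm v)]
  · simp
  · intro i _ hi
    rw [if_neg]
    intro h
    apply hi
    rw [Equiv.eq_symm_apply]
    exact Fin.ext (by omega)
  · simp

lemma bstDepth_eq_letterDepth (n : ℕ) (v : Fin n) (π : Equiv.Perm (Fin n)) :
    bstDepth n (v + 1) π = letterDepth n v π := by
  classical
  have hpos (r : Fin n) : (∀ k ≤ r, π k ≠ v) ↔ r < π.symm v := by
    constructor
    · intro h
      by_contra! h'
      exact h _ h' (by simp)
    · rintro h k hk rfl
      simp only [Equiv.symm_apply_apply] at h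
      exact absurd h (not_lt.2 hk)
  rw [bstDepth, bstRminus, bstRplus, letterDepth, bstN_eq, Finset.card_filter, Finset.card_filter,
    ← Finset.sum_add_distrib]
  refine Finset.sum_congr rfl fun r _ => ?_
  have h1 : (r : ℕ) + 1 < 1 + (π.symm v : ℕ) ↔ r < π.symm v := by
    rw [Fin.lt_def]; omega
  have h2 (k : Fin n) : (π k : ℕ) + 1 < (v : ℕ) + 1 ↔ π k < v := by rw [Fin.lt_def]; omega
  have h3 (k : Fin n) : (π k : ℕ) + 1 > (v : ℕ) + 1 ↔ v < π k := by rw [Fin.lt_def]; omega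
  simp only [h1, h2, h3, hpos]
  by_cases hr : r < π.symm v
  · have hne : π r ≠ v := (hpos r).2 hr r le_rfl
    rcases lt_or_gt_of_ne hne with h | h
    · simp [hr, h, h.not_gt]
    · simp [hr, h, h.not_gt]
  · simp [hr]

lemma forall_lt_last_iff {n : ℕ} {P : Fin (n + 1) → Prop} :
    (∀ k < Fin.last n, P k) ↔ ∀ k : Fin n, P k.castSucc := by
  constructor
  · intro h k
    exact h _ (Fin.castSucc_lt_last k)
  · intro h k hk
    induction k using Fin.lastCases with
    | last => exact absurd hk (lt_irrefl _)
    | cast k => exact h k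

lemma forall_lt_castSucc_iff {n : ℕ} {P : Fin (n + 1) → Prop} (i : Fin n) :
    (∀ k < i.castSucc, P k) ↔ ∀ k < i, P k.castSucc := by
  constructor
  · intro h k hk
    exact h _ (Fin.castSucc_lt_castSucc_iff.2 hk)
  · intro h k hk
    induction k using Fin.lastCases with
    | last => exact absurd hk (Fin.castSucc_lt_last i).not_gt
    | cast k => exact h k (Fin.castSucc_lt_castSucc_iff.1 hk)

lemma forall_le_castSucc_iff {n : ℕ} {P : Fin (n + 1) → Prop} (i : Fin n) :
    (∀ k ≤ i.castSucc, P k) ↔ ∀ k ≤ i, P k.castSucc := by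
  constructor
  · intro h k hk
    exact h _ (Fin.castSucc_le_castSucc_iff.2 hk)
  · intro h k hk
    induction k using Fin.lastCases with
    | last => exact absurd (Fin.castSucc_lt_last i) hk.not_gt
    | cast k => exact h k (Fin.castSucc_le_castSucc_iff.1 hk)

lemma val_succAbove {n : ℕ} (q : Fin (n + 1)) (x : Fin n) :
    (q.succAbove x : ℕ) = if (x : ℕ) < q then (x : ℕ) else x + 1 := by
  rw [Fin.succAbove]
  simp only [Fin.lt_def, Fin.val_castSucc]
  split_ifs <;> simp

lemma cutRecords_append_of_lt {n c : ℕ} {q : Fin (n + 1)} (hq : (q : ℕ) < c) (hc : c ≤ n + 1)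
    (π : Equiv.Perm (Fin n)) :
    cutRecords (n + 1) c (appendPerm q π) =
      cutRecords n (c - 1) π + if (q : ℕ) = c - 1 then 1 else 0 := by
  classical
  have hlt (x : Fin n) : (q.succAbove x : ℕ) < c ↔ (x : ℕ) < c - 1 := by
    rw [val_succAbove]; split_ifs <;> omega
  have hle (x : Fin n) : c ≤ (q.succAbove x : ℕ) ↔ c - 1 ≤ (x : ℕ) := by
    rw [val_succAbove]; split_ifs <;> omega
  rw [cutRecords, cutRecords, Fin.sum_univ_castSucc]
  simp only [forall_lt_castSucc_iff, forall_lt_last_iff, appendPerm_castSucc, appendPerm_last,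
    Fin.succAbove_lt_succAbove_iff, hlt, hle]
  congr 1
  refine if_congr ?_ rfl rfl
  constructor
  · rintro ⟨h, -⟩
    by_contra hne
    have := h hq (π.symm ⟨q, by omega⟩) (by simp; omega)
    simp only [Equiv.apply_symm_apply, Fin.lt_def, val_succAbove] at this
    simp at this
  · intro h
    refine ⟨fun _ k hk => ?_, fun h' => absurd h' (by omega)⟩
    rw [Fin.lt_def, val_succAbove]
    split_ifs <;> omega

lemma cutRecords_append_of_le {n c : ℕ} {q : Fin (n + 1)} (hq : c ≤ (q : ℕ))
    (π : Equiv.Perm (Fin n)) :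
    cutRecords (n + 1) c (appendPerm q π) =
      cutRecords n c π + if (q : ℕ) = c then 1 else 0 := by
  classical
  have hlt (x : Fin n) : (q.succAbove x : ℕ) < c ↔ (x : ℕ) < c := by
    rw [val_succAbove]; split_ifs <;> omega
  have hle (x : Fin n) : c ≤ (q.succAbove x : ℕ) ↔ c ≤ (x : ℕ) := by
    rw [val_succAbove]; split_ifs <;> omega
  rw [cutRecords, cutRecords, Fin.sum_univ_castSucc]
  simp only [forall_lt_castSucc_iff, forall_lt_last_iff, appendPerm_castSucc, appendPerm_last,
    Fin.succAbove_lt_succAbove_iff, hlt, hle]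
  congr 1
  refine if_congr ?_ rfl rfl
  constructor
  · rintro ⟨-, h⟩
    by_contra hne
    have := h hq (π.symm ⟨q - 1, by omega⟩) (by simp; omega)
    simp only [Equiv.apply_symm_apply, Fin.lt_def, val_succAbove] at this
    split_ifs at this <;> omega
  · intro h
    refine ⟨fun h' => absurd h' (by omega), fun _ k hk => ?_⟩
    rw [Fin.lt_def, val_succAbove]
    split_ifs <;> omega

lemma letterDepth_append_self {n : ℕ} (v : Fin (n + 1)) (π : Equiv.Perm (Fin n)) :
    letterDepth (n + 1) v (appendPerm v π) = cutRecords n v π := by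
  classical
  have hlt (x : Fin n) : v.succAbove x < v ↔ (x : ℕ) < v := by
    rw [Fin.lt_def, val_succAbove]; split_ifs <;> omega
  have hle (x : Fin n) : v < v.succAbove x ↔ (v : ℕ) ≤ (x : ℕ) := by
    rw [Fin.lt_def, val_succAbove]; split_ifs <;> omega
  rw [cutRecords, letterDepth, Fin.sum_univ_castSucc, if_neg, add_zero]
  · simp only [forall_lt_castSucc_iff, forall_le_castSucc_iff, appendPerm_castSucc,
      Fin.succAbove_lt_succAbove_iff, hlt, hle, ne_eq, Fin.succAbove_ne, not_false_eq_true,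
      implies_true, true_and]
  · rintro ⟨h, -⟩
    exact h (Fin.last n) le_rfl (by simp)

lemma letterDepth_append_succAbove {n : ℕ} (q : Fin (n + 1)) (v : Fin n)
    (π : Equiv.Perm (Fin n)) :
    letterDepth (n + 1) (q.succAbove v) (appendPerm q π) = letterDepth n v π := by
  classical
  rw [letterDepth, letterDepth, Fin.sum_univ_castSucc, if_neg, add_zero]
  · simp only [forall_lt_castSucc_iff, forall_le_castSucc_iff, appendPerm_castSucc,
      Fin.succAbove_lt_succAbove_iff, ne_eq, Fin.succAbove_right_inj]
  · rintro ⟨h, -⟩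
    exact h (π.symm v).castSucc (Fin.castSucc_lt_last _).le (by simp)

lemma sum_fin_cut {n v : ℕ} (hv : v ≤ n) (F : Fin (n + 1) → ℝ) {x y z : ℝ}
    (h1 : ∀ q : Fin (n + 1), (q : ℕ) < v → F q = x) (h2 : ∀ q : Fin (n + 1), (q : ℕ) = v → F q = y)
    (h3 : ∀ q : Fin (n + 1), v < (q : ℕ) → F q = z) :
    ∑ q, F q = v * x + y + (n - v : ℕ) * z := by
  have e : ∑ q, F q = ∑ q : Fin (n + 1),
      (fun i : ℕ => if i < v then x else if i = v then y else z) q := by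
    refine Finset.sum_congr rfl fun q _ => ?_
    rcases lt_trichotomy (q : ℕ) v with h | h | h
    · simp [h, h1 q h]
    · simp [h, h2 q h]
    · simp [h.not_gt, h.ne', h3 q h]
  obtain ⟨m, rfl⟩ := Nat.exists_eq_add_of_le hv
  rw [e, Fin.sum_univ_eq_sum_range fun i : ℕ => if i < v then x else if i = v then y else z,
    show v + m + 1 = v + (m + 1) by ring, Finset.sum_range_add,
    Finset.sum_range_succ', Finset.sum_congr rfl fun i hi => if_pos (Finset.mem_range.1 hi)]
  simp
  ring

lemma sum_cutRecords (n c : ℕ) (hc : c ≤ n) (f : ℕ → ℝ) :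
    ∑ π : Equiv.Perm (Fin n), f (cutRecords n c π) = n.factorial * recordMean c (n - c) f := by
  induction n generalizing c f with
  | zero =>
    obtain rfl : c = 0 := by omega
    simp [cutRecords, recordMean]
  | succ n ih =>
    rw [sum_appendPerm]
    set F : Fin (n + 1) → ℝ := fun q => ∑ π, f (cutRecords (n + 1) c (appendPerm q π)) with hF
    have lo (q : Fin (n + 1)) (hq : (q : ℕ) < c) (hne : (q : ℕ) ≠ c - 1) :
        F q = n.factorial * recordMean (c - 1) (n - (c - 1)) f := by
      simp only [hF, cutRecords_append_of_lt hq hc, if_neg hne, add_zero]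
      exact ih (c - 1) (by omega) f
    have lo' (q : Fin (n + 1)) (hq : (q : ℕ) < c) (he : (q : ℕ) = c - 1) :
        F q = n.factorial * recordMean (c - 1) (n - (c - 1)) fun k => f (k + 1) := by
      simp only [hF, cutRecords_append_of_lt hq hc, if_pos he]
      exact ih (c - 1) (by omega) fun k => f (k + 1)
    have hi (q : Fin (n + 1)) (hq : c < (q : ℕ)) :
        F q = n.factorial * recordMean c (n - c) f := by
      simp only [hF, cutRecords_append_of_le hq.le, if_neg hq.ne', add_zero]
      exact ih c (by omega) f
    have hi' (q : Fin (n + 1)) (hq : (q : ℕ) = c) :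
        F q = n.factorial * recordMean c (n - c) fun k => f (k + 1) := by
      simp only [hF, cutRecords_append_of_le hq.ge, if_pos hq]
      exact ih c (by omega) fun k => f (k + 1)
    change ∑ q, F q = _
    rw [Nat.factorial_succ]
    rcases c with _ | c
    · rw [sum_fin_cut (Nat.zero_le n) F (x := 0) (fun q hq => absurd hq (Nat.not_lt_zero _)) hi' hi]
      simp only [Nat.sub_zero, recordMean_succ_right]
      push_cast
      field_simp
      ring
    · simp only [Nat.add_sub_cancel] at lo lo'
      rcases hc.eq_or_lt with hc' | hc'
      · obtain rfl : c = n := by omega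
        rw [sum_fin_cut le_rfl F (z := 0) (fun q hq => lo q (by omega) (by omega))
          (fun q hq => lo' q (by omega) hq) (fun q hq => by omega)]
        simp only [Nat.sub_self, recordMean_succ_left]
        push_cast
        field_simp
        ring
      · obtain ⟨d, rfl⟩ : ∃ d, n = c + 1 + d := Nat.exists_eq_add_of_le (by omega)
        have hsplit : ∑ q, F q = (∑ q : Fin (c + 1 + d + 1), if (q : ℕ) < c + 1 then F q else 0) +
            ∑ q : Fin (c + 1 + d + 1), if (q : ℕ) < c + 1 then 0 else F q := by
          rw [← Finset.sum_add_distrib]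
          refine Finset.sum_congr rfl fun q _ => ?_
          split_ifs <;> simp
        rw [hsplit, sum_fin_cut (v := c) (by omega) _ (z := 0)
          (fun q hq => by rw [if_pos (by omega)]; exact lo q (by omega) (by omega))
          (fun q hq => by rw [if_pos (by omega)]; exact lo' q (by omega) hq)
          (fun q hq => if_neg (by omega)),
          sum_fin_cut (v := c + 1) (by omega) _ (x := 0) (fun q hq => if_pos hq)
          (fun q hq => by rw [if_neg (by omega)]; exact hi' q hq)
          (fun q hq => by rw [if_neg (by omega)]; exact hi q hq)]
        have e1 : c + 1 + d - c = d + 1 := by omega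
        have e2 : c + 1 + d + 1 - (c + 1) = d + 1 := by omega
        have e3 : recordMean (c + 1) (d + 1) f * (c + 1 + d + 1) =
            (c * recordMean c (d + 1) f + recordMean c (d + 1) fun k => f (k + 1)) +
            (d * recordMean (c + 1) d f + recordMean (c + 1) d fun k => f (k + 1)) := by
          have l := recordMean_succ_left c (d + 1) f
          have r := recordMean_succ_right (c + 1) d f
          field_simp at l r
          linear_combination l + r
        rw [e1, e2, Nat.add_sub_cancel_left]
        push_cast
        linear_combination -((c + 1 + d).factorial : ℝ) * e3

lemma sum_letterDepth (n : ℕ) (v : Fin n) (f : ℕ → ℝ) :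
    ∑ π : Equiv.Perm (Fin n), f (letterDepth n v π) =
      n.factorial * depthMean v (n - 1 - v) f := by
  induction n generalizing f with
  | zero => exact v.elim0
  | succ n ih =>
    rw [sum_appendPerm, sum_fin_cut (v := v) (by omega) _
      (x := n.factorial * depthMean (v - 1) (n - v) f)
      (y := n.factorial * recordMean v (n - v) f)
      (z := n.factorial * depthMean v (n - 1 - v) f)]
    · rw [depthMean, depthMean, depthMean, prefixMean_rec v (n + 1 - 1 - v), Nat.factorial_succ]
      have h1 : n + 1 - 1 - (v : ℕ) = n - v := rfl
      have h2 : n - (v : ℕ) - 1 = n - 1 - v := by omega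
      have h3 : ((v : ℕ) : ℝ) + (n - v : ℕ) + 1 = n + 1 := by
        rw [← Nat.cast_add, Nat.add_sub_cancel' (by omega)]
      rw [h1, h2, h3]
      push_cast
      field_simp
      ring
    · intro q hq
      have e : q.succAbove ⟨v - 1, by omega⟩ = v := by
        apply Fin.ext; rw [val_succAbove]; simp only; split_ifs <;> omega
      rw [← show n - 1 - (v - 1 : ℕ) = n - v by omega]
      conv_lhs => rw [← e]
      simp only [letterDepth_append_succAbove]
      exact ih _ f
    · intro q hq
      obtain rfl : q = v := Fin.ext hq
      simp only [letterDepth_append_self]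
      exact sum_cutRecords n q (by omega) f
    · intro q hq
      have e : q.succAbove ⟨v, by omega⟩ = v := by
        apply Fin.ext; rw [val_succAbove]; simp only; split_ifs; rfl
      conv_lhs => rw [← e]
      simp only [letterDepth_append_succAbove]
      exact ih _ f

end Permutations

lemma uniformPerm_integral (n : ℕ) (g : Equiv.Perm (Fin n) → ℝ) :
    ∫ π, g π ∂uniformPerm n = (∑ π, g π) / n.factorial := by
  have : MeasurableSingletonClass (Equiv.Perm (Fin n)) := ⟨fun _ => trivial⟩
  rw [uniformPerm, PMF.integral_eq_sum]
  simp only [PMF.uniformOfFintype_apply, Fintype.card_perm, Fintype.card_fin, smul_eq_mul]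
  rw [← Finset.mul_sum, ENNReal.toReal_inv, ENNReal.toReal_natCast]
  field_simp

lemma integral_bstDepth {n l : ℕ} (hl : l ∈ Finset.Icc 1 n) (f : ℕ → ℝ) :
    ∫ π, f (bstDepth n l π) ∂uniformPerm n = depthMean (l - 1) (n - l) f := by
  rw [Finset.mem_Icc] at hl
  obtain ⟨v, rfl⟩ : ∃ v : Fin n, l = v + 1 := ⟨⟨l - 1, by omega⟩, by simp only; omega⟩
  simp only [uniformPerm_integral, bstDepth_eq_letterDepth]
  rw [sum_letterDepth, mul_div_cancel_left₀ _ (by positivity), Nat.add_sub_cancel,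
    show n - 1 - v = n - (v + 1) by omega]

lemma bstExp_eq {n l : ℕ} (hl : l ∈ Finset.Icc 1 n) : bstExp n l = meanDepth (l - 1) (n - l) := by
  rw [bstExp, integral_bstDepth hl (fun k => (k : ℝ)), depthMean, meanDepth]
  simp only [recordMean_id]

instance (n : ℕ) : IsProbabilityMeasure (uniformPerm n) := by
  unfold uniformPerm; infer_instance

lemma map_bstDepth_apply {n l : ℕ} (hl : l ∈ Finset.Icc 1 n) (A : Set ℕ) :
    (Measure.map (bstDepth n l) (uniformPerm n) A).toReal =
      depthMean (l - 1) (n - l) (A.indicator 1) := by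
  have hm : Measurable (bstDepth n l) := fun _ _ => trivial
  rw [← integral_bstDepth hl, ← integral_map hm.aemeasurable
    (measurable_of_countable _).aestronglyMeasurable,
    integral_indicator_one MeasurableSet.of_discrete, measureReal_def]

lemma dTV_le_one (μ ν : Measure ℕ) [IsProbabilityMeasure μ] [IsProbabilityMeasure ν] :
    dTV μ ν ≤ 1 := by
  refine ciSup_le fun A => ?_
  have h1 : μ.real A ≤ 1 := measureReal_le_one
  have h2 : ν.real A ≤ 1 := measureReal_le_one
  have h3 : 0 ≤ μ.real A := measureReal_nonneg
  have h4 : 0 ≤ ν.real A := measureReal_nonneg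
  change |μ.real A - ν.real A| ≤ 1
  rw [abs_le]
  constructor <;> linarith

theorem poisson_approximation_depth (n : ℕ) (hn : 2 ≤ n) :
    ∀ l ∈ Finset.Icc 1 n,
      dTV (Measure.map (bstDepth n l) (uniformPerm n))
          (ProbabilityTheory.poissonMeasure (Real.toNNReal (bstExp n l)))
        ≤ (28 + Real.pi ^ 2) / Real.log n := by
  intro l hl
  have hL : 0 < Real.log n := Real.log_pos (by exact_mod_cast hn)
  have hpi := sq_nonneg Real.pi
  rcases le_or_gt (Real.log n) 28 with h28 | h28
  · have hm : Measurable (bstDepth n l) := fun _ _ => trivial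
    have := Measure.isProbabilityMeasure_map (μ := uniformPerm n) hm.aemeasurable
    refine (dTV_le_one _ _).trans ?_
    rw [le_div_iff₀ hL]
    linarith
  · have hlog := log_le_meanDepth (l - 1) (n - l)
    have hl' := Finset.mem_Icc.1 hl
    rw [show l - 1 + (n - l) + 1 = n by omega] at hlog
    have hpos : 0 < meanDepth (l - 1) (n - l) := by linarith
    rw [bstExp_eq hl]
    refine ciSup_le fun A => ?_
    rw [map_bstDepth_apply hl]
    refine (abs_depthMean_sub_poisson_le _ _ hpos A).trans ?_
    rw [div_le_div_iff₀ hpos hL]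
    nlinarith
end

section
/- Let N ≥ 1, 1 ≤ M ≤ N, 1 ≤ n ≤ N, and let X ~ HypGeo(N; M, n), so that E X = nM/N > 0. Then E(|log(X/(E X))| · 1{X > 0}) ≤ 4N·log N/(nM) + 2·√(N/(nM)). -/
open MeasureTheory ProbabilityTheory Finset Filter
open scoped ENNReal NNReal

/-- Vandermonde's identity, over a range and cast to `ℝ`. -/
theorem sum_range_choose_mul_choose (M K n : ℕ) :
    ∑ k ∈ Finset.range (n + 1), (M.choose k * K.choose (n - k) : ℝ) = (M + K).choose n := by
  rw [Nat.add_choose_eq, Finset.Nat.sum_antidiagonal_eq_sum_range_succ_mk]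
  push_cast
  rfl

/-- Absorption of a factor `k` in a hypergeometric sum. -/
theorem sum_range_mul_choose_succ (M K n : ℕ) (f : ℕ → ℝ) :
    ∑ k ∈ Finset.range (n + 1 + 1),
        (k * f k) * ((M + 1).choose k * K.choose (n + 1 - k) : ℝ)
      = (M + 1) * ∑ k ∈ Finset.range (n + 1), f (k + 1) * (M.choose k * K.choose (n - k) : ℝ) := by
  rw [Finset.sum_range_succ', Finset.mul_sum]
  simp only [Nat.cast_zero, zero_mul, add_zero]
  refine Finset.sum_congr rfl fun k _ => ?_
  have h : ((M : ℝ) + 1) * M.choose k = (M + 1).choose (k + 1) * (k + 1) := by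
    exact_mod_cast Nat.add_one_mul_choose_eq M k
  rw [Nat.add_sub_add_right]
  push_cast
  linear_combination (-f (k + 1) * K.choose (n - k)) * h

theorem add_mul_sum_range_mul_choose (M K n : ℕ) :
    ((M : ℝ) + K) * ∑ k ∈ Finset.range (n + 1), k * (M.choose k * K.choose (n - k) : ℝ)
      = n * M * (M + K).choose n := by
  rcases n with _ | n
  · simp
  rcases M with _ | M
  · have : ∀ k ∈ Finset.range (n + 1 + 1),
        (k : ℝ) * ((Nat.choose 0 k : ℝ) * K.choose (n + 1 - k)) = 0 := by
      intro k _
      rcases k with _ | k <;> simp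
    rw [Finset.sum_eq_zero this]
    simp
  have h := sum_range_mul_choose_succ M K n fun _ => 1
  simp only [mul_one, one_mul] at h
  rw [h, sum_range_choose_mul_choose]
  have h' : ((M : ℝ) + K + 1) * (M + K).choose n = (M + K + 1).choose (n + 1) * (n + 1) := by
    exact_mod_cast Nat.add_one_mul_choose_eq (M + K) n
  rw [show M + 1 + K = M + K + 1 by ring]
  push_cast
  linear_combination ((M : ℝ) + 1) * h'

theorem sum_range_factorial_moment_le (M K n : ℕ) :
    ((M : ℝ) + K) ^ 2 * ∑ k ∈ Finset.range (n + 1),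
        (k * ((k : ℝ) - 1)) * (M.choose k * K.choose (n - k) : ℝ)
      ≤ (n * M) ^ 2 * (M + K).choose n := by
  rcases n with _ | n
  · simp
  rcases M with _ | M
  · have : ∀ k ∈ Finset.range (n + 1 + 1),
        (k * ((k : ℝ) - 1)) * ((Nat.choose 0 k : ℝ) * K.choose (n + 1 - k)) = 0 := by
      intro k _
      rcases k with _ | k <;> simp
    rw [Finset.sum_eq_zero this]
    simp
  rw [sum_range_mul_choose_succ M K n fun k => (k : ℝ) - 1]
  have h₁ := add_mul_sum_range_mul_choose M K n
  simp only [Nat.cast_add, Nat.cast_one, add_sub_cancel_right]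
  set S := ∑ k ∈ Finset.range (n + 1), (k : ℝ) * (M.choose k * K.choose (n - k) : ℝ)
  have h₂ : ((M : ℝ) + K + 1) * (M + K).choose n = (M + K + 1).choose (n + 1) * (n + 1) := by
    exact_mod_cast Nat.add_one_mul_choose_eq (M + K) n
  rw [show M + 1 + K = M + K + 1 by ring]
  set C : ℝ := ((M + K + 1).choose (n + 1) : ℝ)
  set c : ℝ := ((M + K).choose n : ℝ)
  have hc : 0 ≤ c := Nat.cast_nonneg _
  have hm : (0 : ℝ) ≤ M := Nat.cast_nonneg _
  have hk : (0 : ℝ) ≤ K := Nat.cast_nonneg _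
  have hn : (0 : ℝ) ≤ n := Nat.cast_nonneg _
  have key : ((M : ℝ) + K + 1) * S ≤ (n + 1) * (M + 1) * c := by
    rcases (add_nonneg hm hk).eq_or_lt with h | h
    · have hM : (M : ℝ) = 0 := by linarith
      have hM' : M = 0 := by exact_mod_cast hM
      have : S = 0 := by
        refine Finset.sum_eq_zero fun k _ => ?_
        rw [hM']
        rcases k with _ | k <;> simp
      rw [this, mul_zero]
      positivity
    · refine le_of_mul_le_mul_left ?_ h
      have : ((M : ℝ) + K) * ((M + K + 1) * S) = (M + K + 1) * (n * M * c) := by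
        rw [← h₁]; ring
      rw [this]
      have : 0 ≤ (n * K + (M + K) * (M + 1)) * c := by positivity
      linarith
  calc ((M : ℝ) + 1 + K) ^ 2 * ((M + 1) * S)
      = ((M + K + 1) * (M + 1)) * ((M + K + 1) * S) := by ring
    _ ≤ ((M + K + 1) * (M + 1)) * ((n + 1) * (M + 1) * c) := by gcongr
    _ = ((n + 1) * (M + 1)) ^ 2 * C := by
        linear_combination ((M : ℝ) + 1) ^ 2 * (n + 1) * h₂

theorem hypPMF_nonneg (N M n k : ℕ) : 0 ≤ hypPMF N M n k := by
  unfold hypPMF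
  split_ifs <;> positivity

theorem sum_range_hypPMF_mul (N M n : ℕ) (f : ℕ → ℝ) :
    ∑ k ∈ Finset.range (n + 1), hypPMF N M n k * f k
      = (∑ k ∈ Finset.range (n + 1), f k * (M.choose k * (N - M).choose (n - k) : ℝ))
        / N.choose n := by
  rw [Finset.sum_div]
  refine Finset.sum_congr rfl fun k hk => ?_
  rw [hypPMF, if_pos (Nat.lt_succ_iff.mp (Finset.mem_range.mp hk))]
  ring

theorem sum_range_hypPMF {N M n : ℕ} (hMN : M ≤ N) (hnN : n ≤ N) :
    ∑ k ∈ Finset.range (n + 1), hypPMF N M n k = 1 := by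
  have h := sum_range_hypPMF_mul N M n fun _ => 1
  simp only [mul_one, one_mul] at h
  rw [h, sum_range_choose_mul_choose, Nat.add_sub_cancel' hMN]
  exact div_self (Nat.cast_ne_zero.mpr (Nat.choose_pos hnN).ne')

/-- The variance of a hypergeometric variable is at most its mean. -/
theorem hypPMF_variance_le {N M n : ℕ} (hN : 1 ≤ N) (hMN : M ≤ N) (hnN : n ≤ N) :
    ∑ k ∈ Finset.range (n + 1), hypPMF N M n k * ((k : ℝ) - (n : ℝ) * M / N) ^ 2
      ≤ (n : ℝ) * M / N := by
  have hC : (0 : ℝ) < N.choose n := Nat.cast_pos.mpr (Nat.choose_pos hnN)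
  have hN' : (0 : ℝ) < N := by exact_mod_cast hN
  have hK : (M : ℝ) + (N - M : ℕ) = N := by exact_mod_cast Nat.add_sub_cancel' hMN
  have h₁ := add_mul_sum_range_mul_choose M (N - M) n
  have h₂ := sum_range_factorial_moment_le M (N - M) n
  rw [hK, Nat.add_sub_cancel' hMN] at h₁ h₂
  have e₁ : ∑ k ∈ Finset.range (n + 1), hypPMF N M n k * (k : ℝ) = (n : ℝ) * M / N := by
    rw [sum_range_hypPMF_mul, div_eq_div_iff hC.ne' hN'.ne']
    linarith
  have e₂ : ∑ k ∈ Finset.range (n + 1), hypPMF N M n k * (k * ((k : ℝ) - 1))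
      ≤ ((n : ℝ) * M / N) ^ 2 := by
    rw [sum_range_hypPMF_mul, div_pow, div_le_div_iff₀ hC (by positivity)]
    linarith
  set μ : ℝ := (n : ℝ) * M / N
  have e : ∑ k ∈ Finset.range (n + 1), hypPMF N M n k * ((k : ℝ) - μ) ^ 2
      = ∑ k ∈ Finset.range (n + 1), hypPMF N M n k * (k * ((k : ℝ) - 1))
        + (1 - 2 * μ) * ∑ k ∈ Finset.range (n + 1), hypPMF N M n k * (k : ℝ)
        + μ ^ 2 * ∑ k ∈ Finset.range (n + 1), hypPMF N M n k := by
    rw [Finset.mul_sum, Finset.mul_sum, ← Finset.sum_add_distrib, ← Finset.sum_add_distrib]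
    exact Finset.sum_congr rfl fun k _ => by ring
  rw [e, e₁, sum_range_hypPMF hMN hnN]
  linarith

theorem abs_log_le_two_mul_abs_sub_one {x : ℝ} (hx : 1 / 2 ≤ x) :
    |Real.log x| ≤ 2 * |x - 1| := by
  have hx0 : 0 < x := by linarith
  rcases le_total 1 x with h | h
  · rw [abs_of_nonneg (Real.log_nonneg h), abs_of_nonneg (by linarith)]
    linarith [Real.log_le_sub_one_of_pos hx0]
  · rw [abs_of_nonpos (Real.log_nonpos hx0.le h), abs_of_nonpos (by linarith)]
    have h₁ := Real.one_sub_inv_le_log_of_pos hx0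
    have h₂ : x⁻¹ - 1 ≤ 2 * (1 - x) := by
      have : x⁻¹ - 1 = x⁻¹ * (1 - x) := by field_simp
      rw [this]
      have : x⁻¹ ≤ 2 := by
        rw [inv_le_comm₀ hx0 two_pos]; linarith
      exact mul_le_mul_of_nonneg_right this (by linarith)
    linarith

/-- A quadratic majorant of `|log (x / μ)|` on `x ≥ 1`. -/
theorem abs_log_div_le {x μ B : ℝ} (hx : 1 ≤ x) (hμ : 0 < μ) (hμB : μ ≤ B) (hB : 1 ≤ B) :
    |Real.log (x / μ)| ≤ (4 * Real.log B / μ ^ 2 + 1 / (μ * √μ)) * (x - μ) ^ 2 + √μ / μ := by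
  have hs : 0 < √μ := Real.sqrt_pos.mpr hμ
  have hL : 0 ≤ Real.log B := Real.log_nonneg hB
  have hx0 : 0 < x := by linarith
  rw [add_mul, add_assoc]
  rcases lt_or_ge (x / μ) (1 / 2) with h | h
  · have hxμ : x < μ / 2 := by rw [div_lt_iff₀ hμ] at h; linarith
    have h₁ : |Real.log (x / μ)| ≤ Real.log B := by
      rw [abs_of_nonpos (Real.log_nonpos (by positivity) (by linarith)),
        Real.log_div hx0.ne' hμ.ne']
      linarith [Real.log_nonneg hx, Real.log_le_log hμ hμB]
    have h₂ : Real.log B ≤ 4 * Real.log B / μ ^ 2 * (x - μ) ^ 2 := by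
      rw [div_mul_eq_mul_div, le_div_iff₀ (by positivity)]
      have : μ ^ 2 ≤ 4 * (x - μ) ^ 2 := by nlinarith
      nlinarith
    have : 0 ≤ 1 / (μ * √μ) * (x - μ) ^ 2 + √μ / μ := by positivity
    linarith
  · have h₁ := abs_log_le_two_mul_abs_sub_one h
    have h₂ : 2 * |x / μ - 1| ≤ 1 / (μ * √μ) * (x - μ) ^ 2 + √μ / μ := by
      have e : x / μ - 1 = (x - μ) / μ := by field_simp
      have e' : 1 / (μ * √μ) * (x - μ) ^ 2 + √μ / μ = (|x - μ| ^ 2 + √μ ^ 2) / √μ / μ := by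
        rw [sq_abs]; field_simp
      rw [e, abs_div, abs_of_pos hμ, e', ← mul_div_assoc]
      gcongr
      rw [le_div_iff₀ hs]
      nlinarith [sq_nonneg (|x - μ| - √μ)]
    have : 0 ≤ 4 * Real.log B / μ ^ 2 * (x - μ) ^ 2 := by positivity
    linarith

theorem hypgeo_log_moment_bound (N M n : ℕ)
    (hN : 1 ≤ N) (hM : 1 ≤ M) (hMN : M ≤ N) (hn : 1 ≤ n) (hnN : n ≤ N) :
    ∑ k ∈ Finset.range (n + 1),
        hypPMF N M n k * (|Real.log ((k : ℝ) / ((n : ℝ) * M / N))|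
          * (if 0 < k then 1 else 0))
      ≤ 4 * N * Real.log N / ((n : ℝ) * M) + 2 * Real.sqrt ((N : ℝ) / ((n : ℝ) * M)) := by
  have hN' : (1 : ℝ) ≤ N := by exact_mod_cast hN
  have hM' : (1 : ℝ) ≤ M := by exact_mod_cast hM
  have hn' : (1 : ℝ) ≤ n := by exact_mod_cast hn
  have hV := hypPMF_variance_le hN hMN hnN
  have hr : (N : ℝ) / (n * M) = ((n : ℝ) * M / N)⁻¹ := (inv_div _ _).symm
  have hr' : 4 * N * Real.log N / ((n : ℝ) * M) = 4 * Real.log N / ((n : ℝ) * M / N) := by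
    field_simp
  have hμ : 0 < (n : ℝ) * M / N := by positivity
  have hμN : (n : ℝ) * M / N ≤ N := by
    rw [div_le_iff₀ (by linarith)]
    exact_mod_cast Nat.mul_le_mul hnN hMN
  rw [hr, hr', Real.sqrt_inv]
  set μ : ℝ := (n : ℝ) * M / N
  have hs : 0 < √μ := Real.sqrt_pos.mpr hμ
  have hL : 0 ≤ Real.log N := Real.log_nonneg hN'
  set a : ℝ := 4 * Real.log N / μ ^ 2 + 1 / (μ * √μ) with ha
  have ha0 : 0 ≤ a := by positivity
  calc _ ≤ ∑ k ∈ Finset.range (n + 1), hypPMF N M n k * (a * ((k : ℝ) - μ) ^ 2 + √μ / μ) := by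
        refine Finset.sum_le_sum fun k _ =>
          mul_le_mul_of_nonneg_left ?_ (hypPMF_nonneg N M n k)
        split_ifs with hk
        · rw [mul_one]
          exact abs_log_div_le (by exact_mod_cast hk) hμ hμN hN'
        · rw [mul_zero]
          positivity
    _ = a * ∑ k ∈ Finset.range (n + 1), hypPMF N M n k * ((k : ℝ) - μ) ^ 2
        + √μ / μ * ∑ k ∈ Finset.range (n + 1), hypPMF N M n k := by
        rw [Finset.mul_sum, Finset.mul_sum, ← Finset.sum_add_distrib]
        exact Finset.sum_congr rfl fun k _ => by ring
    _ ≤ a * μ + √μ / μ := by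
        rw [sum_range_hypPMF hMN hnN, mul_one]
        gcongr
    _ = 4 * Real.log N / μ + 2 * (√μ)⁻¹ := by
        rw [Real.sqrt_div_self', ha]
        field_simp
        ring
end
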